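/- arXiv:2208.14680 — 2 statements merged into one kernel-verified Lean document; each statement's English description precedes it below -/
import Mathlib

section
/- Let k be an algebraically closed field of characteristic p > 0, let G be a normal subgroup of a finite group G̃, and let M be a finitely generated kG-module such that xM ≅ M as kG-modules for every x ∈ G̃. Then Ind_G^{G̃} Ω(M) ≅ Ω(Ind_G^{G̃} M) as kG̃-modules, where Ind_G^{G̃} = kG̃ ⊗_{kG} (−) is the induction functor and Ω denotes the syzygy (kernel of the projective cover map). -/
/-!
Common definitions: τ-tilting theory over a ring, blocks of group algebras,
conjugate modules and induced modules.

Since group algebras (and their blocks) are symmetric algebras, the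
Auslander–Reiten translate is `τ = Ω²` computed via (minimal) projective covers;
τ-rigidity is formulated accordingly.  Support τ-tilting modules are formulated
via support τ-tilting pairs: `M` is support τ-tilting iff `M` is τ-rigid and
there is a projective module `P` with `Hom(P, M) = 0` and `|M| + |P| = |Λ|`
(the number of simple modules), which is the standard equivalent
characterisation (Adachi–Iyama–Reiten, Prop. 2.3; Remark 2.2 of the paper).
-/

universe u

section GeneralDefs

variable (A : Type u) [Ring A]

/-- A module is indecomposable if it is nontrivial and has no nontrivial
direct sum decomposition. -/
def IsIndecModule (X : Type u) [AddCommGroup X] [Module A X] : Prop :=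
  Nontrivial X ∧ ∀ U V : Submodule A X, IsCompl U V → U = ⊥ ∨ V = ⊥

/-- `|M|`: the number of isomorphism classes of indecomposable direct summands
of `M`. -/
noncomputable def numIndec (M : Type u) [AddCommGroup M] [Module A M] : ℕ :=
  Nat.card (Quot fun
    (L L' : {L : Submodule A M // (∃ L'', IsCompl L L'') ∧ IsIndecModule A L}) =>
      Nonempty (L.1 ≃ₗ[A] L'.1))

/-- `|A|`: the number of isomorphism classes of simple `A`-modules. -/
noncomputable def numSimples : ℕ :=
  Nat.card (Quot fun (X Y : {X : ModuleCat.{u} A // IsSimpleModule A X}) =>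
    Nonempty ((X.1 : Type u) ≃ₗ[A] (Y.1 : Type u)))

/-- The number of isomorphism classes of simple `A`-modules lying in the block
with block idempotent `b` (i.e. on which `b` acts as the identity). -/
noncomputable def numSimplesIn (b : A) : ℕ :=
  Nat.card (Quot fun
    (X Y : {X : ModuleCat.{u} A //
        IsSimpleModule A X ∧ ∀ v : (X : Type u), b • v = v}) =>
      Nonempty ((X.1 : Type u) ≃ₗ[A] (Y.1 : Type u)))

/-- `π : P → M` is a projective cover: `P` is projective, `π` is surjective and
`ker π` is superfluous (i.e. `π` is an essential epimorphism). -/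
def IsProjCover {P M : Type u} [AddCommGroup P] [Module A P]
    [AddCommGroup M] [Module A M] (π : P →ₗ[A] M) : Prop :=
  Module.Projective A P ∧ Function.Surjective π ∧
    ∀ N : Submodule A P, N ⊔ LinearMap.ker π = ⊤ → N = ⊤

/-- `M` is τ-rigid: `Hom(M, τ M) = 0`, where for the symmetric algebras
considered here `τ M = Ω² M` is computed from minimal projective presentations:
for (any) projective cover `π₀ : P₀ → M` and projective cover
`π₁ : P₁ → ker π₀`, one has `τ M = ker π₁`. -/
def IsTauRigid (M : Type u) [AddCommGroup M] [Module A M] : Prop :=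
  ∀ (P₀ : Type u) [AddCommGroup P₀] [Module A P₀] (π₀ : P₀ →ₗ[A] M),
    IsProjCover A π₀ →
    ∀ (P₁ : Type u) [AddCommGroup P₁] [Module A P₁]
      (π₁ : P₁ →ₗ[A] ↥(LinearMap.ker π₀)),
      IsProjCover A π₁ →
      ∀ g : M →ₗ[A] ↥(LinearMap.ker π₁), g = 0

/-- `M` is a support τ-tilting `A`-module (via support τ-tilting pairs):
`M` is τ-rigid and there is a (finitely generated) projective `A`-module `P`
with `Hom_A(P, M) = 0` and `|M| + |P| = |A|`. -/
def IsSupportTauTilting (M : Type u) [AddCommGroup M] [Module A M] : Prop :=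
  IsTauRigid A M ∧
  ∃ P : ModuleCat.{u} A, Module.Projective A P ∧ Module.Finite A P ∧
    (∀ f : (P : Type u) →ₗ[A] M, f = 0) ∧
    numIndec A M + numIndec A (P : Type u) = numSimples A

/-- `b` is a block idempotent: a primitive central idempotent of `A`.
The corresponding block is `B = A * b`. -/
def IsBlockIdem (b : A) : Prop :=
  b ≠ 0 ∧ b * b = b ∧ (∀ r : A, b * r = r * b) ∧
  ∀ c : A, c * c = c → (∀ r : A, c * r = r * c) → b * c = c → c = 0 ∨ c = b

/-- `M` is a support τ-tilting module over the block `B` with block idempotent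
`b`: `M` lies in `B`, is τ-rigid (over `B`, equivalently over `A`) and there is
a projective module `P` lying in `B` with `Hom(P, M) = 0` and
`|M| + |P| = |B|`. -/
def IsSupportTauTiltingBlock (b : A) (M : Type u) [AddCommGroup M]
    [Module A M] : Prop :=
  (∀ m : M, b • m = m) ∧ IsTauRigid A M ∧
  ∃ P : ModuleCat.{u} A, Module.Projective A P ∧ Module.Finite A P ∧
    (∀ v : (P : Type u), b • v = v) ∧
    (∀ f : (P : Type u) →ₗ[A] M, f = 0) ∧
    numIndec A M + numIndec A (P : Type u) = numSimplesIn A b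

/-- The partial order on support τ-tilting modules: `M ≥ M'` iff there are
`r > 0` and an epimorphism `M^{⊕ r} ↠ M'`. -/
def stGE (M M' : Type u) [AddCommGroup M] [Module A M]
    [AddCommGroup M'] [Module A M'] : Prop :=
  ∃ r : ℕ, 0 < r ∧ ∃ φ : (Fin r → M) →ₗ[A] M', Function.Surjective φ

/-- `X ∈ add M`: `X` is a direct summand of a finite direct sum of copies
of `M`. -/
def InAdd (M X : Type u) [AddCommGroup M] [Module A M]
    [AddCommGroup X] [Module A X] : Prop :=
  ∃ (n : ℕ) (i : X →ₗ[A] (Fin n → M)) (p : (Fin n → M) →ₗ[A] X),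
    p.comp i = LinearMap.id

/-- For a central idempotent `b` of `A`, the direct summand `b • N` of an
`A`-module `N`, realised as the submodule of elements on which `b` acts as the
identity. -/
def blockComponent (b : A) (hb : ∀ r : A, b * r = r * b)
    (N : Type u) [AddCommGroup N] [Module A N] : Submodule A N where
  carrier := {n | b • n = n}
  add_mem' := by
    intro a c ha hc
    simp only [Set.mem_setOf_eq, smul_add] at *
    rw [ha, hc]
  zero_mem' := by simp
  smul_mem' := by
    intro r n hn
    simp only [Set.mem_setOf_eq] at *
    rw [← mul_smul, hb, mul_smul, hn]

end GeneralDefs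

section InducedDefs

/-- `(N, j)` is the module induced from `M` along the ring homomorphism
`ι : R →+* S`, i.e. `N ≅ S ⊗_R M`, characterised by the universal property of
extension of scalars: `j : M → N` is `R`-linear (with `R` acting on `N` via
`ι`) and every `R`-linear map from `M` to (the restriction of) an `S`-module
`X` factors uniquely through an `S`-linear map `N → X`. -/
def IsInducedMod {R S : Type u} [Ring R] [Ring S] (ι : R →+* S)
    (M : Type u) [AddCommGroup M] [Module R M]
    (N : Type u) [AddCommGroup N] [Module S N] (j : M →+ N) : Prop :=
  (∀ (r : R) (m : M), j (r • m) = ι r • j m) ∧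
  ∀ (X : Type u) [AddCommGroup X] [Module S X] (f : M →+ X),
    (∀ (r : R) (m : M), f (r • m) = ι r • f m) →
    ∃! g : N →ₗ[S] X, ∀ m : M, g (j m) = f m

end InducedDefs

section GroupDefs

variable (k : Type u) [Field k] (Gt : Type u) [Group Gt] (G : Subgroup Gt)
  [G.Normal]

/-- The ring automorphism of `kG` induced by conjugation by `x ∈ G̃` on the
normal subgroup `G`. -/
noncomputable def conjRingHom (x : Gt) :
    MonoidAlgebra k ↥G →+* MonoidAlgebra k ↥G :=
  MonoidAlgebra.mapDomainRingHom k (MulAut.conjNormal (H := G) x)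

/-- The ring homomorphism `kG →+* kG̃` induced by the inclusion `G ≤ G̃`. -/
noncomputable def inclRingHom : MonoidAlgebra k ↥G →+* MonoidAlgebra k Gt :=
  MonoidAlgebra.mapDomainRingHom k G.subtype

/-- `x M ≅ M`: the conjugate module `x M` (with `g` acting as `x⁻¹ g x` does
on `M`) is isomorphic to `M`; equivalently, there is an additive automorphism
of `M` which is semilinear for the conjugation automorphism of `kG`. -/
def IsConjStable (x : Gt) (M : Type u) [AddCommGroup M]
    [Module (MonoidAlgebra k ↥G) M] : Prop :=
  ∃ φ : M ≃+ M, ∀ (r : MonoidAlgebra k ↥G) (m : M),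
    φ (conjRingHom k Gt G x r • m) = r • φ m

end GroupDefs

section Superfluous

/-- A submodule is superfluous if it can be dropped from any sum equal to the whole module. -/
def IsSuperfluous {R M : Type*} [Ring R] [AddCommGroup M] [Module R M]
    (K : Submodule R M) : Prop :=
  ∀ N : Submodule R M, N ⊔ K = ⊤ → N = ⊤

variable {R R' M M' : Type*} [Ring R] [Ring R'] [AddCommGroup M] [Module R M]
  [AddCommGroup M'] [Module R' M']

theorem IsSuperfluous.mono {K L : Submodule R M} (hL : IsSuperfluous L) (h : K ≤ L) :
    IsSuperfluous K := fun N hN =>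
  hL N (top_le_iff.1 (hN ▸ sup_le_sup_left h N))

theorem IsSuperfluous.map {σ : R →+* R'} [RingHomSurjective σ] {K : Submodule R M}
    (hK : IsSuperfluous K) (f : M →ₛₗ[σ] M') : IsSuperfluous (K.map f) := by
  intro N hN
  have hcomap : N.comap f = ⊤ := by
    refine hK _ (Submodule.eq_top_iff'.2 fun m => ?_)
    have hm : f m ∈ N ⊔ K.map f := hN ▸ Submodule.mem_top
    obtain ⟨n, hn, _, ⟨κ, hκ, rfl⟩, h⟩ := Submodule.mem_sup.1 hm
    refine Submodule.mem_sup.2 ⟨m - κ, ?_, κ, hκ, sub_add_cancel _ _⟩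
    rw [Submodule.mem_comap, map_sub, ← h, add_sub_cancel_right]
    exact hn
  have hle : K.map f ≤ N := Submodule.map_le_iff_le_comap.2 (hcomap ▸ le_top)
  rwa [sup_eq_left.2 hle] at hN

theorem IsSuperfluous.finset_sup {ι : Type*} (s : Finset ι) {K : ι → Submodule R M}
    (hK : ∀ i, IsSuperfluous (K i)) : IsSuperfluous (s.sup K) := by
  classical
  induction s using Finset.induction_on with
  | empty => intro N hN; simpa using hN
  | insert a s _ ih =>
    intro N hN
    rw [Finset.sup_insert, ← sup_assoc] at hN
    exact hK a N (ih _ hN)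

end Superfluous

section ProjCover

variable {A : Type u} [Ring A] {P Q M : Type u} [AddCommGroup P] [Module A P]
  [AddCommGroup Q] [Module A Q] [AddCommGroup M] [Module A M]

/-- Projective covers of the same module are isomorphic over it. -/
theorem IsProjCover.exists_equiv {π : P →ₗ[A] M} {ϖ : Q →ₗ[A] M}
    (hπ : IsProjCover A π) (hϖ : IsProjCover A ϖ) :
    ∃ e : P ≃ₗ[A] Q, ∀ x, ϖ (e x) = π x := by
  obtain ⟨hP, hπs, hπk⟩ := hπ
  obtain ⟨hQ, hϖs, hϖk⟩ := hϖ
  obtain ⟨h, hh⟩ := Module.projective_lifting_property ϖ π hϖs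
  have hh' : ∀ x, ϖ (h x) = π x := fun x => LinearMap.congr_fun hh x
  have hsurj : Function.Surjective h := by
    refine LinearMap.range_eq_top.1 (hϖk _ (Submodule.eq_top_iff'.2 fun q => ?_))
    obtain ⟨x, hx⟩ := hπs (ϖ q)
    exact Submodule.mem_sup.2 ⟨h x, ⟨x, rfl⟩, q - h x, by simp [hh', hx], by simp⟩
  obtain ⟨s, hs⟩ := Module.projective_lifting_property h LinearMap.id hsurj
  have hs' : ∀ q, h (s q) = q := fun q => LinearMap.congr_fun hs q
  have hssurj : Function.Surjective s := by
    refine LinearMap.range_eq_top.1 (hπk _ (Submodule.eq_top_iff'.2 fun x => ?_))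
    exact Submodule.mem_sup.2 ⟨s (h x), ⟨h x, rfl⟩, x - s (h x), by simp [← hh', hs'], by simp⟩
  have hinj : Function.Injective h :=
    (Function.RightInverse.leftInverse_of_surjective hs' hssurj).injective
  exact ⟨LinearEquiv.ofBijective h ⟨hinj, hsurj⟩, hh'⟩

theorem IsProjCover.nonempty_ker_equiv {π : P →ₗ[A] M} {ϖ : Q →ₗ[A] M}
    (hπ : IsProjCover A π) (hϖ : IsProjCover A ϖ) :
    Nonempty (LinearMap.ker π ≃ₗ[A] LinearMap.ker ϖ) := by
  obtain ⟨e, he⟩ := hπ.exists_equiv hϖ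
  refine ⟨e.ofSubmodules _ _ ?_⟩
  ext q
  rw [Submodule.mem_map_equiv, LinearMap.mem_ker, LinearMap.mem_ker, ← he, e.apply_symm_apply]

theorem IsProjCover.comp_equiv {M' : Type u} [AddCommGroup M'] [Module A M'] {π : P →ₗ[A] M}
    (hπ : IsProjCover A π) (e : M ≃ₗ[A] M') : IsProjCover A (e.toLinearMap ∘ₗ π) := by
  obtain ⟨hP, hs, hk⟩ := hπ
  refine ⟨hP, e.surjective.comp hs, ?_⟩
  rwa [LinearEquiv.ker_comp]

end ProjCover

namespace IsInducedMod

variable {R S : Type u} [Ring R] [Ring S] {ι : R →+* S}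
  {M : Type u} [AddCommGroup M] [Module R M]
  {N : Type u} [AddCommGroup N] [Module S N] {j : M →+ N}

theorem hom_ext (h : IsInducedMod ι M N j) {X : Type u} [AddCommGroup X] [Module S X]
    {g g' : N →ₗ[S] X} (hg : ∀ m, g (j m) = g' (j m)) : g = g' := by
  obtain ⟨_, _, huniq⟩ := h.2 X (g'.toAddMonoidHom.comp j) fun r m => by simp [h.1]
  exact (huniq g hg).trans (huniq g' fun _ => rfl).symm

theorem exists_equiv (h : IsInducedMod ι M N j)
    {N' : Type u} [AddCommGroup N'] [Module S N'] {j' : M →+ N'}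
    (h' : IsInducedMod ι M N' j') : Nonempty (N ≃ₗ[S] N') := by
  obtain ⟨f, hf, -⟩ := h.2 N' j' h'.1
  obtain ⟨g, hg, -⟩ := h'.2 N j h.1
  exact ⟨LinearEquiv.ofLinearMap f g (h'.hom_ext fun m => by simp [hf, hg])
    (h.hom_ext fun m => by simp [hf, hg])⟩

/-- Induction preserves projectivity. -/
theorem projective (h : IsInducedMod ι M N j) [Module.Projective R M] :
    Module.Projective S N := by
  refine Module.Projective.of_lifting_property'' fun f hf => ?_
  let _ : Module R N := Module.compHom N ι
  let _ : Module R (N →₀ S) := Module.compHom (N →₀ S) ι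
  let j' : M →ₗ[R] N := { j with map_smul' := h.1 }
  let f' : (N →₀ S) →ₗ[R] N := { f with map_smul' := fun r x => f.map_smul (ι r) x }
  obtain ⟨l, hl⟩ := Module.projective_lifting_property f' j' hf
  obtain ⟨g, hg, -⟩ := h.2 (N →₀ S) l.toAddMonoidHom fun r m => l.map_smul r m
  refine ⟨g, h.hom_ext fun m => ?_⟩
  rw [LinearMap.comp_apply, hg]
  exact LinearMap.congr_fun hl m

end IsInducedMod

section MonoidAlgebra

variable {k H X Y R : Type*} [Field k] [Monoid H] [AddCommGroup X] [Module (MonoidAlgebra k H) X]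
  [AddCommGroup Y]

/-- Semilinearity over a monoid algebra can be checked on monomials. -/
theorem MonoidAlgebra.map_smul_of_single [Ring R] [Module R Y] (σ : MonoidAlgebra k H →+* R)
    (f : X →+ Y)
    (hf : ∀ (h : H) (a : k) (x : X),
      f (MonoidAlgebra.single h a • x) = σ (MonoidAlgebra.single h a) • f x)
    (r : MonoidAlgebra k H) (x : X) : f (r • x) = σ r • f x := by
  induction r using MonoidAlgebra.induction_linear with
  | zero => simp
  | add r s hr hs => simp only [add_smul, map_add, hr, hs]
  | single h a => exact hf h a x

/-- The linear map over a monoid algebra given by an additive map that commutes with monomials. -/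
def AddMonoidHom.linearMapOfSingle [Module (MonoidAlgebra k H) Y] (f : X →+ Y)
    (hf : ∀ (h : H) (a : k) (x : X),
      f (MonoidAlgebra.single h a • x) = MonoidAlgebra.single h a • f x) :
    X →ₗ[MonoidAlgebra k H] Y :=
  { f with
    map_smul' := fun r x =>
      MonoidAlgebra.map_smul_of_single (RingHom.id (MonoidAlgebra k H)) f hf r x }

end MonoidAlgebra

section Coinduced

variable (k : Type u) [Field k] (Gt : Type u) [Group Gt] (G : Subgroup Gt)

/-- The module of `G`-equivariant functions `G̃ → U`. For finite `G̃` it is a model of the module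
induced from `U`. -/
def CoindMod (U : Type u) [AddCommGroup U] [Module k U] [Module (MonoidAlgebra k ↥G) U]
    [IsScalarTower k (MonoidAlgebra k ↥G) U] : Type u :=
  (Representation.coind G.subtype (Representation.ofModule' (k := k) (G := ↥G) U)).asModule

namespace CoindMod

variable (U : Type u) [AddCommGroup U] [Module k U] [Module (MonoidAlgebra k ↥G) U]
    [IsScalarTower k (MonoidAlgebra k ↥G) U]

noncomputable instance : AddCommGroup (CoindMod k Gt G U) :=
  inferInstanceAs (AddCommGroup (Representation.asModule _))

noncomputable instance : Module (MonoidAlgebra k Gt) (CoindMod k Gt G U) :=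
  inferInstanceAs (Module (MonoidAlgebra k Gt) (Representation.asModule _))

variable {k Gt G U}

/-- Evaluation of an equivariant function at a group element. -/
noncomputable def eval (x : Gt) : CoindMod k Gt G U →+ U where
  toFun f := (Representation.asModuleEquiv _ f).1 x
  map_zero' := rfl
  map_add' _ _ := rfl

theorem ext {f f' : CoindMod k Gt G U} (h : ∀ x, eval x f = eval x f') : f = f' :=
  Subtype.ext (funext h)

theorem eval_mul (f : CoindMod k Gt G U) (g : G) (x : Gt) :
    eval (g * x) f = MonoidAlgebra.single g (1 : k) • eval x f :=
  (Representation.asModuleEquiv _ f).2 g x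

/-- The element of `CoindMod` with a given equivariant function. -/
noncomputable def mk (f : Gt → U) (hf : ∀ (g : G) (x : Gt), f (g * x) = MonoidAlgebra.single g (1 : k) • f x) :
    CoindMod k Gt G U :=
  (Representation.asModuleEquiv _).symm ⟨f, hf⟩

@[simp]
theorem eval_mk (f : Gt → U)
    (hf : ∀ (g : G) (x : Gt), f (g * x) = MonoidAlgebra.single g (1 : k) • f x) (x : Gt) :
    eval x (mk f hf) = f x := rfl

theorem eval_single_smul (x y : Gt) (a : k) (f : CoindMod k Gt G U) :
    eval x (MonoidAlgebra.single y a • f) = a • eval (x * y) f := by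
  have h := Representation.single_smul
    (Representation.coind G.subtype (Representation.ofModule' (k := k) (G := ↥G) U)) a y f
  exact congrArg (eval x) h

section Map

variable {V : Type u} [AddCommGroup V] [Module k V] [Module (MonoidAlgebra k ↥G) V]
    [IsScalarTower k (MonoidAlgebra k ↥G) V]

/-- Composition with a `kG`-linear map. -/
noncomputable def map (φ : U →ₗ[MonoidAlgebra k ↥G] V) :
    CoindMod k Gt G U →ₗ[MonoidAlgebra k Gt] CoindMod k Gt G V :=
  AddMonoidHom.linearMapOfSingle
    { toFun := fun f => mk (fun x => φ (eval x f)) fun g x => by rw [eval_mul, map_smul]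
      map_zero' := ext fun x => by simp
      map_add' := fun f f' => ext fun x => by simp } fun y a f => ext fun x => by
        simp only [AddMonoidHom.coe_mk, ZeroHom.coe_mk, eval_mk, eval_single_smul]
        exact (φ.restrictScalars k).map_smul a _

@[simp]
theorem eval_map (φ : U →ₗ[MonoidAlgebra k ↥G] V) (f : CoindMod k Gt G U) (x : Gt) :
    eval x (map φ f) = φ (eval x f) := rfl

end Map

open Classical in
variable (k Gt G U) in
/-- The element `u` of `U` as the function supported on `G` sending `1` to `u`. -/
noncomputable def incl : U →+ CoindMod k Gt G U where
  toFun u := mk (fun x => if h : x ∈ G then MonoidAlgebra.single (⟨x, h⟩ : G) (1 : k) • u else 0)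
    fun g x => by
      by_cases h : x ∈ G
      · have h' : (g : Gt) * x ∈ G := G.mul_mem g.2 h
        rw [dif_pos h, dif_pos h', smul_smul, MonoidAlgebra.single_mul_single, one_mul]
        rfl
      · have h' : (g : Gt) * x ∉ G := fun h' => h ((G.mul_mem_cancel_left g.2).1 h')
        rw [dif_neg h, dif_neg h', smul_zero]
  map_zero' := ext fun x => by simp
  map_add' u v := ext fun x => by
    by_cases h : x ∈ G <;> simp [h]

theorem eval_incl_of_mem {x : Gt} (h : x ∈ G) (u : U) :
    eval x (incl k Gt G U u) = MonoidAlgebra.single (⟨x, h⟩ : G) (1 : k) • u :=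
  dif_pos h

theorem eval_incl_of_notMem {x : Gt} (h : x ∉ G) (u : U) :
    eval x (incl k Gt G U u) = 0 :=
  dif_neg h

theorem inclRingHom_single (g : G) (a : k) :
    inclRingHom k Gt G (MonoidAlgebra.single g a) = MonoidAlgebra.single (g : Gt) a := by
  simp [inclRingHom]

theorem incl_smul (r : MonoidAlgebra k ↥G) (u : U) :
    incl k Gt G U (r • u) = inclRingHom k Gt G r • incl k Gt G U u := by
  refine MonoidAlgebra.map_smul_of_single _ _ (fun g a u => ext fun x => ?_) r u
  rw [inclRingHom_single, eval_single_smul]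
  by_cases h : x ∈ G
  · have h' : x * g ∈ G := G.mul_mem h g.2
    rw [eval_incl_of_mem h, eval_incl_of_mem h', smul_smul, ← smul_assoc,
      MonoidAlgebra.single_mul_single, one_mul, MonoidAlgebra.smul_single, smul_eq_mul, mul_one]
    rfl
  · have h' : x * g ∉ G := fun h' => h ((G.mul_mem_cancel_right g.2).1 h')
    rw [eval_incl_of_notMem h, eval_incl_of_notMem h', smul_zero]

section Induce

variable {X : Type u} [AddCommGroup X] [Module (MonoidAlgebra k Gt) X] (φ : U →+ X)
  (hφ : ∀ (r : MonoidAlgebra k ↥G) (u : U), φ (r • u) = inclRingHom k Gt G r • φ u)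

/-- The contribution of a left coset to the map induced by `φ`. -/
noncomputable def cosetTerm (f : CoindMod k Gt G U) : Gt ⧸ G → X :=
  Quotient.lift (fun z : Gt => MonoidAlgebra.single z (1 : k) • φ (eval z⁻¹ f)) <| by
    intro z w hzw
    obtain ⟨g, rfl⟩ : ∃ g : G, z * g = w :=
      ⟨⟨z⁻¹ * w, QuotientGroup.leftRel_apply.1 hzw⟩, by simp⟩
    have h := eval_mul f g⁻¹ z⁻¹
    simp only [mul_inv_rev]
    rw [InvMemClass.coe_inv] at h
    rw [h, hφ, inclRingHom_single, smul_smul, MonoidAlgebra.single_mul_single]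
    simp

@[simp]
theorem cosetTerm_mk (f : CoindMod k Gt G U) (z : Gt) :
    cosetTerm φ hφ f (z : Gt ⧸ G) = MonoidAlgebra.single z (1 : k) • φ (eval z⁻¹ f) := rfl

theorem cosetTerm_smul (y : Gt) (a : k) (f : CoindMod k Gt G U) (q : Gt ⧸ G) :
    cosetTerm φ hφ (MonoidAlgebra.single y a • f) (y • q) =
      MonoidAlgebra.single y a • cosetTerm φ hφ f q := by
  induction q using QuotientGroup.induction_on with
  | H z =>
    have ha : ∀ u : U, φ (a • u) = MonoidAlgebra.single (1 : Gt) a • φ u := fun u => by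
      rw [← one_smul (MonoidAlgebra k ↥G) u, ← smul_assoc, MonoidAlgebra.one_def,
        MonoidAlgebra.smul_single, smul_eq_mul, mul_one, hφ, inclRingHom_single,
        ← MonoidAlgebra.one_def, one_smul]
      rfl
    rw [MulAction.Quotient.smul_coe, smul_eq_mul, cosetTerm_mk, cosetTerm_mk, eval_single_smul, ha,
      smul_smul, smul_smul, MonoidAlgebra.single_mul_single, MonoidAlgebra.single_mul_single]
    simp

variable [Fintype Gt]

open Classical in
/-- The `kG̃`-linear map induced by the `kG`-linear map `φ`. -/
noncomputable def induce : CoindMod k Gt G U →ₗ[MonoidAlgebra k Gt] X :=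
  AddMonoidHom.linearMapOfSingle
    { toFun := fun f => ∑ q, cosetTerm φ hφ f q
      map_zero' := Finset.sum_eq_zero fun q _ => by
        induction q using QuotientGroup.induction_on with | H z => simp
      map_add' := fun f f' => by
        rw [← Finset.sum_add_distrib]
        refine Finset.sum_congr rfl fun q _ => ?_
        induction q using QuotientGroup.induction_on with | H z => simp } fun y a f => by
      simp only [AddMonoidHom.coe_mk, ZeroHom.coe_mk, Finset.smul_sum]
      exact (Equiv.sum_comp (MulAction.toPerm y) _).symm.trans
        (Finset.sum_congr rfl fun q _ => cosetTerm_smul φ hφ y a f q)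

open Classical in
theorem induce_apply (f : CoindMod k Gt G U) :
    induce φ hφ f = ∑ q, cosetTerm φ hφ f q := rfl

theorem induce_incl (u : U) : induce φ hφ (incl k Gt G U u) = φ u := by
  classical
  rw [induce_apply, Finset.sum_eq_single ((1 : Gt) : Gt ⧸ G)]
  · rw [cosetTerm_mk, eval_incl_of_mem (by simp), hφ, inclRingHom_single, smul_smul,
      MonoidAlgebra.single_mul_single]
    simp [← MonoidAlgebra.one_def]
  · intro q _ hq
    induction q using QuotientGroup.induction_on with
    | H z =>
      have hz : z⁻¹ ∉ G := fun hz => hq (QuotientGroup.eq.2 (by simpa using hz))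
      rw [cosetTerm_mk, eval_incl_of_notMem hz, map_zero, smul_zero]
  · simp

theorem induce_self (f : CoindMod k Gt G U) :
    induce (incl k Gt G U) incl_smul f = f := by
  classical
  refine ext fun y => ?_
  rw [induce_apply, map_sum, Finset.sum_eq_single ((y⁻¹ : Gt) : Gt ⧸ G)]
  · rw [cosetTerm_mk, eval_single_smul, one_smul, eval_incl_of_mem (by simp), ← eval_mul]
    simp
  · intro q _ hq
    induction q using QuotientGroup.induction_on with
    | H z =>
      have hz : y * z ∉ G := fun hz => hq (QuotientGroup.eq.2 (by
        simpa using G.inv_mem hz))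
      rw [cosetTerm_mk, eval_single_smul, one_smul, eval_incl_of_notMem hz]
  · simp

end Induce

/-- Every element is a sum of translates of values supported on `G`. -/
theorem eq_sum_out [Fintype Gt] [Fintype (Gt ⧸ G)] (f : CoindMod k Gt G U) :
    f = ∑ q : Gt ⧸ G, MonoidAlgebra.single q.out (1 : k) • incl k Gt G U (eval q.out⁻¹ f) := by
  conv_lhs => rw [← induce_self f, induce_apply]
  refine Finset.sum_congr (by congr!) fun q _ => ?_
  conv_lhs => rw [← q.out_eq]
  exact cosetTerm_mk _ _ f q.out

theorem isInducedMod [Fintype Gt] :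
    IsInducedMod (inclRingHom k Gt G) U (CoindMod k Gt G U) (incl k Gt G U) := by
  classical
  refine ⟨incl_smul, fun X _ _ φ hφ => ⟨induce φ hφ, induce_incl φ hφ, fun g hg => ?_⟩⟩
  ext f
  rw [eq_sum_out f, map_sum, map_sum]
  refine Finset.sum_congr rfl fun q _ => ?_
  rw [map_smul, map_smul, hg, induce_incl]

section Map

variable {V : Type u} [AddCommGroup V] [Module k V] [Module (MonoidAlgebra k ↥G) V]
    [IsScalarTower k (MonoidAlgebra k ↥G) V]

theorem map_injective {φ : U →ₗ[MonoidAlgebra k ↥G] V} (hφ : Function.Injective φ) :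
    Function.Injective (map (Gt := Gt) φ) := fun f f' h =>
  ext fun x => hφ (by simpa using congrArg (eval x) h)

theorem map_incl (φ : U →ₗ[MonoidAlgebra k ↥G] V) (u : U) :
    map φ (incl k Gt G U u) = incl k Gt G V (φ u) := by
  refine ext fun x => ?_
  by_cases h : x ∈ G
  · rw [eval_map, eval_incl_of_mem h, eval_incl_of_mem h, map_smul]
  · rw [eval_map, eval_incl_of_notMem h, eval_incl_of_notMem h, map_zero]

theorem map_surjective [Fintype Gt] {φ : U →ₗ[MonoidAlgebra k ↥G] V}
    (hφ : Function.Surjective φ) : Function.Surjective (map (Gt := Gt) φ) := by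
  classical
  intro f
  choose s hs using hφ
  refine ⟨∑ q : Gt ⧸ G, MonoidAlgebra.single q.out (1 : k) •
    incl k Gt G U (s (eval q.out⁻¹ f)), ?_⟩
  conv_rhs => rw [eq_sum_out f]
  rw [map_sum]
  exact Finset.sum_congr rfl fun q _ => by rw [map_smul, map_incl, hs]

/-- The coinduced module of a kernel is the kernel of the coinduced map. -/
noncomputable def kerEquiv (φ : U →ₗ[MonoidAlgebra k ↥G] V) :
    CoindMod k Gt G (LinearMap.ker φ) ≃ₗ[MonoidAlgebra k Gt]
      LinearMap.ker (map (Gt := Gt) φ) :=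
  (LinearEquiv.ofInjective (map (LinearMap.ker φ).subtype)
    (map_injective (Submodule.subtype_injective _))).trans <|
  LinearEquiv.ofEq _ _ <| by
    ext f
    rw [LinearMap.mem_range, LinearMap.mem_ker]
    constructor
    · rintro ⟨f, rfl⟩
      exact ext fun x => (eval x f).2
    · intro hf
      exact ⟨mk (fun x => ⟨eval x f, by simpa using congrArg (eval x) hf⟩)
        fun g x => Subtype.ext (eval_mul f g x), rfl⟩

variable [G.Normal]

theorem single_mul_inclRingHom (x : Gt) (r : MonoidAlgebra k ↥G) :
    MonoidAlgebra.single x (1 : k) * inclRingHom k Gt G r =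
      inclRingHom k Gt G (conjRingHom k Gt G x r) * MonoidAlgebra.single x (1 : k) := by
  induction r using MonoidAlgebra.induction_linear with
  | zero => simp
  | add r s hr hs => simp only [map_add, mul_add, add_mul, hr, hs]
  | single g a =>
    simp [conjRingHom, inclRingHom_single, MonoidAlgebra.single_mul_single]

theorem conjRingHom_surjective (x : Gt) : Function.Surjective (conjRingHom k Gt G x) := by
  intro r
  induction r using MonoidAlgebra.induction_linear with
  | zero => exact ⟨0, map_zero _⟩
  | add r s hr hs =>
    obtain ⟨r, rfl⟩ := hr
    obtain ⟨s, rfl⟩ := hs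
    exact ⟨r + s, map_add _ _ _⟩
  | single g a =>
    refine ⟨MonoidAlgebra.single ((MulAut.conjNormal x).symm g) a, ?_⟩
    simp [conjRingHom]

theorem isSuperfluous_ker_map [Fintype Gt] {φ : U →ₗ[MonoidAlgebra k ↥G] V}
    (hφ : IsSuperfluous (LinearMap.ker φ)) :
    IsSuperfluous (LinearMap.ker (map (Gt := Gt) φ)) := by
  classical
  let _ : Module (MonoidAlgebra k ↥G) (CoindMod k Gt G U) :=
    Module.compHom _ (inclRingHom k Gt G)
  let _ : Module (MonoidAlgebra k ↥G) (MonoidAlgebra k Gt) :=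
    Module.compHom _ (inclRingHom k Gt G)
  have : IsScalarTower (MonoidAlgebra k ↥G) (MonoidAlgebra k Gt) (CoindMod k Gt G U) :=
    ⟨fun r s f => mul_smul (inclRingHom k Gt G r) s f⟩
  have : ∀ x, RingHomSurjective (conjRingHom k Gt G x) := fun x => ⟨conjRingHom_surjective x⟩
  let F : ∀ x : Gt, U →ₛₗ[conjRingHom k Gt G x] CoindMod k Gt G U := fun x =>
    { toFun := fun u => MonoidAlgebra.single x (1 : k) • incl k Gt G U u
      map_add' := fun u v => by rw [map_add, smul_add]
      map_smul' := fun r u => by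
        rw [incl_smul, smul_smul, single_mul_inclRingHom, mul_smul]
        rfl }
  have hle : (LinearMap.ker (map (Gt := Gt) φ)).restrictScalars (MonoidAlgebra k ↥G) ≤
      Finset.univ.sup fun x => (LinearMap.ker φ).map (F x) := by
    intro f hf
    rw [eq_sum_out f]
    refine Submodule.sum_mem _ fun q _ => ?_
    refine Finset.le_sup (f := fun x => (LinearMap.ker φ).map (F x))
      (Finset.mem_univ q.out) ⟨eval q.out⁻¹ f, ?_, rfl⟩
    simpa using congrArg (eval q.out⁻¹) (LinearMap.mem_ker.1 hf)
  intro N hN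
  refine (Submodule.restrictScalars_eq_top_iff (MonoidAlgebra k ↥G) _ _).1 <|
    (IsSuperfluous.finset_sup Finset.univ fun x => hφ.map (F x)).mono hle _ <|
      Submodule.eq_top_iff'.2 fun f => ?_
  have hf : f ∈ N ⊔ LinearMap.ker (map (Gt := Gt) φ) := hN ▸ Submodule.mem_top
  obtain ⟨n, hn, κ, hκ, h⟩ := Submodule.mem_sup.1 hf
  exact Submodule.mem_sup.2 ⟨n, hn, κ, hκ, h⟩

/-- Induction from a normal subgroup preserves projective covers. -/
theorem isProjCover_map [Fintype Gt] {φ : U →ₗ[MonoidAlgebra k ↥G] V}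
    (hφ : IsProjCover (MonoidAlgebra k ↥G) φ) :
    IsProjCover (MonoidAlgebra k Gt) (map (Gt := Gt) φ) :=
  have := hφ.1
  ⟨isInducedMod.projective, map_surjective hφ.2.1, isSuperfluous_ker_map hφ.2.2⟩

end Map

end CoindMod

end Coinduced

/-- If `x M ≅ M` for all `x ∈ G̃`, then
`Ind_G^{G̃} Ω(M) ≅ Ω(Ind_G^{G̃} M)`. -/
theorem induced_syzygy_iso_syzygy_induced
    (k : Type u) [Field k] [IsAlgClosed k] (p : ℕ) (hp : 0 < p) [CharP k p]
    (Gt : Type u) [Group Gt] [Fintype Gt] (G : Subgroup Gt) [G.Normal]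
    (M : Type u) [AddCommGroup M] [Module (MonoidAlgebra k ↥G) M]
    [Module.Finite (MonoidAlgebra k ↥G) M]
    (hM : ∀ x : Gt, IsConjStable k Gt G x M)
    -- a projective cover of M over kG, with syzygy Ω(M) = ker π₀
    (P₀ : Type u) [AddCommGroup P₀] [Module (MonoidAlgebra k ↥G) P₀]
    (π₀ : P₀ →ₗ[MonoidAlgebra k ↥G] M)
    (hπ₀ : IsProjCover (MonoidAlgebra k ↥G) π₀)
    -- the induced module of M
    (N : Type u) [AddCommGroup N] [Module (MonoidAlgebra k Gt) N]
    (jM : M →+ N) (hN : IsInducedMod (inclRingHom k Gt G) M N jM)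
    -- the induced module of Ω(M)
    (NΩ : Type u) [AddCommGroup NΩ] [Module (MonoidAlgebra k Gt) NΩ]
    (jΩ : ↥(LinearMap.ker π₀) →+ NΩ)
    (hNΩ : IsInducedMod (inclRingHom k Gt G) ↥(LinearMap.ker π₀) NΩ jΩ)
    -- a projective cover of Ind M over kG̃, with syzygy Ω(Ind M) = ker ϖ₀
    (Q₀ : Type u) [AddCommGroup Q₀] [Module (MonoidAlgebra k Gt) Q₀]
    (ϖ₀ : Q₀ →ₗ[MonoidAlgebra k Gt] N)
    (hϖ₀ : IsProjCover (MonoidAlgebra k Gt) ϖ₀) :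
    Nonempty (NΩ ≃ₗ[MonoidAlgebra k Gt] ↥(LinearMap.ker ϖ₀)) := by
  let _ : Module k M := Module.compHom M (algebraMap k (MonoidAlgebra k ↥G))
  let _ : Module k P₀ := Module.compHom P₀ (algebraMap k (MonoidAlgebra k ↥G))
  have : IsScalarTower k (MonoidAlgebra k ↥G) M :=
    ⟨fun a r m => by rw [Algebra.smul_def, mul_smul]; rfl⟩
  have : IsScalarTower k (MonoidAlgebra k ↥G) P₀ :=
    ⟨fun a r m => by rw [Algebra.smul_def, mul_smul]; rfl⟩
  obtain ⟨eΩ⟩ := hNΩ.exists_equiv (CoindMod.isInducedMod (k := k))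
  obtain ⟨eM⟩ := (CoindMod.isInducedMod (k := k)).exists_equiv hN
  have hcover := (CoindMod.isProjCover_map (Gt := Gt) hπ₀).comp_equiv eM
  obtain ⟨e⟩ := hcover.nonempty_ker_equiv hϖ₀
  exact ⟨eΩ ≪≫ₗ CoindMod.kerEquiv π₀ ≪≫ₗ
    LinearEquiv.ofEq _ _ (LinearEquiv.ker_comp eM _).symm ≪≫ₗ e⟩
end

section
/- Let k be an algebraically closed field of characteristic p > 0, let G be a normal subgroup of a finite group G̃, and let M be a finitely generated kG-module such that xM ≅ M as kG-modules for every x ∈ G̃. Then τ(Ind_G^{G̃} M) ≅ Ind_G^{G̃}(τM) as kG̃-modules, where τ denotes the Auslander–Reiten translate. -/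
/-!
Common definitions: τ-tilting theory over a ring, blocks of group algebras,
conjugate modules and induced modules.

Since group algebras (and their blocks) are symmetric algebras, the
Auslander–Reiten translate is `τ = Ω²` computed via (minimal) projective covers;
τ-rigidity is formulated accordingly.  Support τ-tilting modules are formulated
via support τ-tilting pairs: `M` is support τ-tilting iff `M` is τ-rigid and
there is a projective module `P` with `Hom(P, M) = 0` and `|M| + |P| = |Λ|`
(the number of simple modules), which is the standard equivalent
characterisation (Adachi–Iyama–Reiten, Prop. 2.3; Remark 2.2 of the paper).
-/

universe u

section ProjCover

variable {A : Type u} [Ring A]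

/-- Projective covers of isomorphic modules have isomorphic kernels. -/
theorem IsProjCover.nonempty_ker_equiv_s3 {P P' M M' : Type u}
    [AddCommGroup P] [Module A P] [AddCommGroup P'] [Module A P']
    [AddCommGroup M] [Module A M] [AddCommGroup M'] [Module A M']
    {π : P →ₗ[A] M} {π' : P' →ₗ[A] M'} (h : IsProjCover A π) (h' : IsProjCover A π')
    (e : M ≃ₗ[A] M') :
    Nonempty (LinearMap.ker π ≃ₗ[A] LinearMap.ker π') := by
  obtain ⟨hP, hπ, hs⟩ := h
  obtain ⟨hP', hπ', hs'⟩ := h'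
  obtain ⟨f, hf⟩ := Module.projective_lifting_property π' (e.toLinearMap ∘ₗ π) hπ'
  replace hf (x) : π' (f x) = e (π x) := LinearMap.congr_fun hf x
  have hfs : Function.Surjective f := by
    rw [← LinearMap.range_eq_top]
    refine hs' _ (eq_top_iff.2 fun y _ => ?_)
    obtain ⟨x, hx⟩ := hπ (e.symm (π' y))
    refine Submodule.mem_sup.2 ⟨f x, ⟨x, rfl⟩, y - f x, ?_, by abel⟩
    simp [hf, hx]
  obtain ⟨s, hfs'⟩ := Module.projective_lifting_property f LinearMap.id hfs
  replace hfs' (y) : f (s y) = y := LinearMap.congr_fun hfs' y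
  have hπs (y) : e (π (s y)) = π' y := by rw [← hf, hfs']
  have hss : Function.Surjective s := by
    rw [← LinearMap.range_eq_top]
    refine hs _ (eq_top_iff.2 fun x _ => ?_)
    refine Submodule.mem_sup.2 ⟨s (f x), ⟨f x, rfl⟩, x - s (f x), ?_, by abel⟩
    rw [LinearMap.mem_ker, map_sub, sub_eq_zero]
    apply e.injective
    rw [hπs, hf]
  have hsi : Function.Injective s := Function.LeftInverse.injective hfs'
  let E := LinearEquiv.ofBijective s ⟨hsi, hss⟩
  refine ⟨(E.submoduleMap (LinearMap.ker π') ≪≫ₗ LinearEquiv.ofEq _ _ ?_).symm⟩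
  ext x
  constructor
  · rintro ⟨y, hy, rfl⟩
    apply e.injective
    rw [map_zero]
    exact (hπs y).trans hy
  · intro hx
    obtain ⟨y, rfl⟩ := hss x
    refine ⟨y, ?_, rfl⟩
    change π' y = 0
    rw [← hπs, show π (s y) = 0 from hx, map_zero]

/-- A supremum of finitely many superfluous elements is superfluous. -/
theorem eq_top_of_sup_iSup_eq_top {L I : Type*} [CompleteLattice L] [Fintype I] {B : I → L}
    (hB : ∀ i a, a ⊔ B i = ⊤ → a = ⊤) {a : L} (h : a ⊔ ⨆ i, B i = ⊤) : a = ⊤ := by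
  classical
  have key (T : Finset I) : ∀ a, a ⊔ T.sup B = ⊤ → a = ⊤ := by
    induction T using Finset.induction_on with
    | empty => intro a ha; simpa using ha
    | insert i T _ ih =>
      intro a ha
      rw [Finset.sup_insert, ← sup_assoc] at ha
      exact hB i a (ih _ ha)
  refine key Finset.univ a ?_
  rwa [Finset.sup_univ_eq_iSup]

/-- The image of a submodule under an additive map whose range and fibres are compatible with
the scalars up to a twist. -/
def twistedMap {P C : Type*} [AddCommGroup P] [Module A P] [AddCommGroup C] [Module A C]
    (f : P →+ C) (hf : ∀ r : A, ∃ r' : A, ∀ p, r • f p = f (r' • p)) (K : Submodule A P) :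
    Submodule A C where
  toAddSubmonoid := K.toAddSubmonoid.map f
  smul_mem' := by
    rintro r _ ⟨p, hp, rfl⟩
    obtain ⟨r', hr'⟩ := hf r
    exact ⟨r' • p, K.smul_mem r' hp, (hr' p).symm⟩

/-- The image of a superfluous submodule under a twisted linear map is superfluous. -/
theorem eq_top_of_sup_twistedMap_eq_top {P C : Type*} [AddCommGroup P] [Module A P]
    [AddCommGroup C] [Module A C] (f : P →+ C)
    (hf : ∀ r : A, ∃ r' : A, ∀ p, r • f p = f (r' • p))
    (hf' : ∀ r : A, ∃ r' : A, ∀ p, f (r • p) = r' • f p) {K : Submodule A P}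
    (hK : ∀ N : Submodule A P, N ⊔ K = ⊤ → N = ⊤) {T : Submodule A C}
    (hT : T ⊔ twistedMap f hf K = ⊤) : T = ⊤ := by
  let T' : Submodule A P :=
    { toAddSubmonoid := T.toAddSubmonoid.comap f
      smul_mem' := by
        intro r p hp
        obtain ⟨r', hr'⟩ := hf' r
        change f (r • p) ∈ T
        rw [hr']
        exact T.smul_mem r' hp }
  have hT' : T' = ⊤ := by
    refine hK _ (eq_top_iff.2 fun p _ => ?_)
    obtain ⟨t, ht, _, ⟨κ, hκ, rfl⟩, h⟩ := Submodule.mem_sup.1 (hT ▸ Submodule.mem_top (x := f p))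
    refine Submodule.mem_sup.2 ⟨p - κ, ?_, κ, hκ, by abel⟩
    change f (p - κ) ∈ T
    rw [map_sub, ← h]
    simpa using ht
  rw [← hT, eq_comm, sup_eq_left]
  rintro _ ⟨p, -, rfl⟩
  change p ∈ T'
  simp [hT']

end ProjCover

section InducedUnique

/-- Induced modules are unique up to isomorphism. -/
theorem IsInducedMod.nonempty_equiv {R S : Type u} [Ring R] [Ring S] {ι : R →+* S}
    {M : Type u} [AddCommGroup M] [Module R M]
    {N N' : Type u} [AddCommGroup N] [Module S N] [AddCommGroup N'] [Module S N']
    {j : M →+ N} {j' : M →+ N'} (h : IsInducedMod ι M N j) (h' : IsInducedMod ι M N' j') :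
    Nonempty (N ≃ₗ[S] N') := by
  obtain ⟨f, hf, -⟩ := h.2 N' j' h'.1
  obtain ⟨g, hg, -⟩ := h'.2 N j h.1
  refine ⟨LinearEquiv.ofLinearMap f g ?_ ?_⟩
  · exact (h'.2 N' j' h'.1).unique (fun m => by simp only [LinearMap.comp_apply, hg, hf])
      (fun m => rfl)
  · exact (h.2 N j h.1).unique (fun m => by simp only [LinearMap.comp_apply, hg, hf])
      (fun m => rfl)

/-- Induction preserves projectivity. -/
theorem IsInducedMod.projective_s3 {R S : Type u} [Ring R] [Ring S] {ι : R →+* S}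
    {P : Type u} [AddCommGroup P] [Module R P] [Module.Projective R P]
    {N : Type u} [AddCommGroup N] [Module S N] {j : P →+ N} (h : IsInducedMod ι P N j) :
    Module.Projective S N := by
  refine Module.Projective.of_lifting_property (fun {X Y} _ _ _ _ q g hq => ?_)
  let _ : Module R X := Module.compHom X ι
  let _ : Module R Y := Module.compHom Y ι
  let qR : X →ₗ[R] Y := { q with map_smul' := fun r x => q.map_smul (ι r) x }
  let gR : P →ₗ[R] Y :=
    { (g : N →+ Y).comp j with
      map_smul' := fun r x => (congrArg g (h.1 r x)).trans (g.map_smul (ι r) (j x)) }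
  obtain ⟨l, hl⟩ := Module.projective_lifting_property qR gR hq
  obtain ⟨L, hL, -⟩ := h.2 X l (fun r m => l.map_smul r m)
  refine ⟨L, (h.2 Y gR (fun r m => gR.map_smul r m)).unique (fun m => ?_) (fun m => rfl)⟩
  rw [LinearMap.comp_apply, hL]
  exact LinearMap.congr_fun hl m

end InducedUnique

section Coinduced

variable {R S : Type u} [Ring R] [Ring S]

/-- The coinduced module `Hom_R(S, M)`, as a group of additive maps. -/
def Coind (ι : R →+* S) (M : Type u) [AddCommGroup M] [Module R M] : AddSubgroup (S →+ M) where
  carrier := {f | ∀ r s, f (ι r * s) = r • f s}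
  add_mem' := by
    intro f g hf hg r s
    simp [hf r s, hg r s]
  zero_mem' := by simp
  neg_mem' := by
    intro f hf r s
    simp [hf r s]

namespace Coind

variable {ι : R →+* S} {M M' : Type u} [AddCommGroup M] [Module R M]
  [AddCommGroup M'] [Module R M']

theorem apply_mul (f : Coind ι M) (r : R) (s : S) : f.1 (ι r * s) = r • f.1 s := f.2 r s

@[ext]
theorem ext {f g : Coind ι M} (h : ∀ s, f.1 s = g.1 s) : f = g :=
  Subtype.ext (AddMonoidHom.ext h)

instance : SMul S (Coind ι M) where
  smul s f := ⟨f.1.comp (AddMonoidHom.mulRight s), fun r t => by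
    simp [mul_assoc, apply_mul f]⟩

theorem smul_apply (s : S) (f : Coind ι M) (t : S) : (s • f).1 t = f.1 (t * s) := rfl

instance : Module S (Coind ι M) where
  one_smul f := by ext; simp [smul_apply]
  mul_smul a b f := by ext; simp [smul_apply, mul_assoc]
  smul_zero a := by ext; simp [smul_apply]
  smul_add a f g := by ext; simp [smul_apply]
  add_smul a b f := by ext; simp [smul_apply, mul_add]
  zero_smul f := by ext; simp [smul_apply]

/-- Functoriality of coinduction. -/
def map (ι : R →+* S) (π : M →ₗ[R] M') : Coind ι M →ₗ[S] Coind ι M' where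
  toFun f := ⟨(π : M →+ M').comp f.1, fun r s => by simp [apply_mul f]⟩
  map_add' f g := by ext; simp
  map_smul' s f := by ext; simp [smul_apply]

theorem map_apply (π : M →ₗ[R] M') (f : Coind ι M) (s : S) : (map ι π f).1 s = π (f.1 s) := rfl

/-- Coinduction preserves kernels. -/
def kerEquiv (π : M →ₗ[R] M') :
    LinearMap.ker (map ι π) ≃ₗ[S] Coind ι (LinearMap.ker π) where
  toFun f := ⟨f.1.1.codRestrict (LinearMap.ker π).toAddSubgroup fun s =>
      congrArg (fun g : Coind ι M' => g.1 s) f.2,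
    fun r s => Subtype.ext (apply_mul f.1 r s)⟩
  invFun f := ⟨map ι (LinearMap.ker π).subtype f, by
    rw [LinearMap.mem_ker]
    ext s
    exact (f.1 s).2⟩
  left_inv _ := rfl
  right_inv _ := rfl
  map_add' _ _ := rfl
  map_smul' _ _ := rfl

end Coind

/-- A Frobenius system for a ring extension `ι : R →+* S`: a bimodule map `ρ : S → R` together
with dual bases `x` and `y`, where every `y i` normalises the image of `R`. -/
structure FrobeniusSystem (ι : R →+* S) (I : Type*) [Fintype I] where
  /-- The Frobenius homomorphism. -/
  ρ : S →+ R
  /-- The first dual basis. -/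
  x : I → S
  /-- The second dual basis. -/
  y : I → S
  map_mul_left : ∀ r s, ρ (ι r * s) = r * ρ s
  map_mul_right : ∀ s r, ρ (s * ι r) = ρ s * r
  sum_left : ∀ s, ∑ i, ι (ρ (s * y i)) * x i = s
  sum_right : ∀ s, ∑ i, y i * ι (ρ (x i * s)) = s
  exists_mul_eq : ∀ i r, ∃ r', y i * ι r = ι r' * y i
  exists_mul_eq' : ∀ i r, ∃ r', ι r * y i = y i * ι r'

namespace FrobeniusSystem

variable {ι : R →+* S} {I : Type*} [Fintype I] (F : FrobeniusSystem ι I)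
  {M M' : Type u} [AddCommGroup M] [Module R M] [AddCommGroup M'] [Module R M']

/-- The unit `M → Hom_R(S, M)`. -/
def unit (M : Type u) [AddCommGroup M] [Module R M] : M →+ Coind ι M where
  toFun m := ⟨((smulAddHom R M).flip m).comp F.ρ, fun r s => by
    simp [F.map_mul_left, mul_smul]⟩
  map_zero' := by ext; simp
  map_add' _ _ := by ext; simp

theorem unit_apply (m : M) (s : S) : (F.unit M m).1 s = F.ρ s • m := rfl

theorem unit_smul (r : R) (m : M) : F.unit M (r • m) = ι r • F.unit M m := by
  ext s
  rw [Coind.smul_apply, unit_apply, unit_apply, F.map_mul_right, mul_smul]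

theorem sum_smul_unit (f : Coind ι M) : ∑ i, F.y i • F.unit M (f.1 (F.x i)) = f := by
  ext t
  rw [AddSubgroup.val_finsetSum, AddMonoidHom.finsetSum_apply]
  conv_rhs => rw [← F.sum_left t, map_sum]
  exact Finset.sum_congr rfl fun i _ => (Coind.apply_mul f _ _).symm

/-- Coinduction along a Frobenius extension is induction. -/
theorem isInducedMod (M : Type u) [AddCommGroup M] [Module R M] :
    IsInducedMod ι M (Coind ι M) (F.unit M) := by
  refine ⟨F.unit_smul, fun X _ _ f hf => ?_⟩
  let g : Coind ι M →ₗ[S] X :=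
    { toFun := fun φ => ∑ i, F.y i • f (φ.1 (F.x i))
      map_add' := fun φ ψ => by simp [Finset.sum_add_distrib]
      map_smul' := fun s φ => by
        have h (i) : φ.1 (F.x i * s) = ∑ j, F.ρ (F.x i * s * F.y j) • φ.1 (F.x j) := by
          conv_lhs => rw [← F.sum_left (F.x i * s), map_sum]
          exact Finset.sum_congr rfl fun j _ => Coind.apply_mul φ _ _
        simp only [Coind.smul_apply, h, map_sum, hf, Finset.smul_sum, RingHom.id_apply]
        rw [Finset.sum_comm]
        refine Finset.sum_congr rfl fun j _ => ?_
        conv_rhs => rw [← mul_smul, ← F.sum_right (s * F.y j), Finset.sum_smul]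
        simp only [mul_smul, mul_assoc] }
  refine ⟨g, fun m => ?_, fun g' hg' => ?_⟩
  · change ∑ i, F.y i • f (F.ρ (F.x i) • m) = f m
    simp only [hf]
    have h := F.sum_right 1
    simp only [mul_one] at h
    conv_rhs => rw [← one_smul S (f m), ← h, Finset.sum_smul]
    simp only [mul_smul]
  · ext φ
    conv_lhs => rw [← F.sum_smul_unit φ, map_sum]
    simp only [map_smul, hg']
    rfl

theorem map_surjective (F : FrobeniusSystem ι I) {π : M →ₗ[R] M'} (hπ : Function.Surjective π) :
    Function.Surjective (Coind.map ι π) := by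
  intro f
  choose m hm using fun i => hπ (f.1 (F.x i))
  refine ⟨∑ i, F.y i • F.unit M (m i), ?_⟩
  conv_rhs => rw [← F.sum_smul_unit f]
  rw [map_sum]
  refine Finset.sum_congr rfl fun i _ => ?_
  rw [map_smul, ← hm]
  congr 1
  ext s
  simp [Coind.map_apply, unit_apply]

/-- Induction along a normal Frobenius extension preserves projective covers. -/
theorem isProjCover_map (F : FrobeniusSystem ι I) {π : M →ₗ[R] M'}
    (h : IsProjCover R π) :
    IsProjCover S (Coind.map ι π) := by
  obtain ⟨hP, hπ, hs⟩ := h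
  refine ⟨(F.isInducedMod M).projective_s3, F.map_surjective hπ, fun T hT => ?_⟩
  let _ : Module R (Coind ι M) := Module.compHom _ ι
  have smul_def (r : R) (c : Coind ι M) : r • c = ι r • c := rfl
  let TR : Submodule R (Coind ι M) :=
    { T.toAddSubmonoid with smul_mem' := fun r c hc => T.smul_mem (ι r) hc }
  let f (i : I) : M →+ Coind ι M := (DistribSMul.toAddMonoidHom _ (F.y i)).comp (F.unit M)
  have f_apply (i m) : f i m = F.y i • F.unit M m := rfl
  have hf (i : I) (r : R) : ∃ r' : R, ∀ m, r • f i m = f i (r' • m) := by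
    obtain ⟨r', hr'⟩ := F.exists_mul_eq' i r
    exact ⟨r', fun m => by
      rw [smul_def, f_apply, f_apply, F.unit_smul, ← mul_smul, ← mul_smul, hr']⟩
  have hf' (i : I) (r : R) : ∃ r' : R, ∀ m, f i (r • m) = r' • f i m := by
    obtain ⟨r', hr'⟩ := F.exists_mul_eq i r
    exact ⟨r', fun m => by
      rw [smul_def, f_apply, f_apply, F.unit_smul, ← mul_smul, ← mul_smul, hr']⟩
  have key : TR = ⊤ := by
    refine eq_top_of_sup_iSup_eq_top (B := fun i => twistedMap (f i) (hf i) (LinearMap.ker π))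
      (fun i T' hT' => eq_top_of_sup_twistedMap_eq_top (f i) (hf i) (hf' i) hs hT') ?_
    refine eq_top_iff.2 fun c _ => ?_
    obtain ⟨t, ht, κ, hκ, rfl⟩ := Submodule.mem_sup.1 (hT ▸ Submodule.mem_top (x := c))
    refine Submodule.add_mem_sup ht ?_
    rw [← F.sum_smul_unit κ]
    refine Submodule.sum_mem _ fun i _ => Submodule.mem_iSup_of_mem i ?_
    exact ⟨κ.1 (F.x i), congrArg (fun g : Coind ι M' => g.1 (F.x i)) hκ, rfl⟩
  refine eq_top_iff.2 fun c _ => ?_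
  change c ∈ TR
  simp [key]

end FrobeniusSystem

end Coinduced

section GroupAlgebra

variable (k : Type u) [Field k] (Gt : Type u) [Group Gt] (G : Subgroup Gt)

open MonoidAlgebra

/-- The projection `kG̃ → kG` restricting coefficients to `G`. -/
noncomputable def restrictCoeff : MonoidAlgebra k Gt →+ MonoidAlgebra k G :=
  MonoidAlgebra.comapDomainAddMonoidHom G.subtype G.subtype_injective

variable {Gt G}

theorem inclRingHom_single [G.Normal] (g : G) (a : k) :
    inclRingHom k Gt G (single g a) = single (g : Gt) a :=
  MonoidAlgebra.mapDomain_single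

theorem restrictCoeff_single_coe (g : G) (a : k) :
    restrictCoeff k Gt G (single (g : Gt) a) = single g a :=
  MonoidAlgebra.comapDomain_single_map _ G.subtype_injective g a

theorem restrictCoeff_single_of_notMem {g : Gt} (hg : g ∉ G) (a : k) :
    restrictCoeff k Gt G (single g a) = 0 :=
  MonoidAlgebra.comapDomain_single_of_not_mem_range (by simpa using hg)
    G.subtype_injective

theorem restrictCoeff_inclRingHom_mul [G.Normal] (r : MonoidAlgebra k G)
    (s : MonoidAlgebra k Gt) :
    restrictCoeff k Gt G (inclRingHom k Gt G r * s) = r * restrictCoeff k Gt G s := by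
  induction r using MonoidAlgebra.induction_linear with
  | zero => simp
  | add r r' h h' => simp [add_mul, h, h']
  | single g a =>
    induction s using MonoidAlgebra.induction_linear with
    | zero => simp
    | add s s' h h' => simp [mul_add, h, h']
    | single x b =>
      rw [inclRingHom_single, single_mul_single]
      by_cases hx : x ∈ G
      · lift x to G using hx
        rw [← Subgroup.coe_mul, restrictCoeff_single_coe, restrictCoeff_single_coe,
          single_mul_single]
      · rw [restrictCoeff_single_of_notMem k hx, restrictCoeff_single_of_notMem k
          (by rwa [G.mul_mem_cancel_left g.2]), mul_zero]

theorem restrictCoeff_mul_inclRingHom [G.Normal] (s : MonoidAlgebra k Gt)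
    (r : MonoidAlgebra k G) :
    restrictCoeff k Gt G (s * inclRingHom k Gt G r) = restrictCoeff k Gt G s * r := by
  induction r using MonoidAlgebra.induction_linear with
  | zero => simp
  | add r r' h h' => simp [mul_add, h, h']
  | single g a =>
    induction s using MonoidAlgebra.induction_linear with
    | zero => simp
    | add s s' h h' => simp [add_mul, h, h']
    | single x b =>
      rw [inclRingHom_single, single_mul_single]
      by_cases hx : x ∈ G
      · lift x to G using hx
        rw [← Subgroup.coe_mul, restrictCoeff_single_coe, restrictCoeff_single_coe,
          single_mul_single]
      · rw [restrictCoeff_single_of_notMem k hx, restrictCoeff_single_of_notMem k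
          (by rwa [G.mul_mem_cancel_right g.2]), zero_mul]

theorem inclRingHom_conjRingHom_mul_single [G.Normal] (x : Gt) (r : MonoidAlgebra k G) :
    inclRingHom k Gt G (conjRingHom k Gt G x r) * single x 1 =
      single x 1 * inclRingHom k Gt G r := by
  induction r using MonoidAlgebra.induction_linear with
  | zero => simp
  | add r r' h h' => simp only [map_add, add_mul, mul_add, h, h']
  | single g a =>
    have h : conjRingHom k Gt G x (single g a) = single (MulAut.conjNormal x g) a :=
      MonoidAlgebra.mapDomain_single
    rw [h, inclRingHom_single, inclRingHom_single, single_mul_single, single_mul_single]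
    simp

theorem conjRingHom_conjRingHom_inv [G.Normal] (x : Gt) (r : MonoidAlgebra k G) :
    conjRingHom k Gt G x (conjRingHom k Gt G x⁻¹ r) = r := by
  induction r using MonoidAlgebra.induction_linear with
  | zero => simp
  | add r r' h h' => simp only [map_add, h, h']
  | single g a =>
    have h (y : Gt) (g : G) : conjRingHom k Gt G y (single g a) =
        single (MulAut.conjNormal y g) a := MonoidAlgebra.mapDomain_single
    rw [h, h]
    simp

variable (Gt G)

/-- The group algebra of a group is a Frobenius extension of the group algebra of a normal
subgroup of finite index, with dual bases given by coset representatives. -/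
noncomputable def groupFrobeniusSystem [G.Normal] [Fintype (Gt ⧸ G)] :
    FrobeniusSystem (inclRingHom k Gt G) (Gt ⧸ G) where
  ρ := restrictCoeff k Gt G
  x c := single (Quotient.out c)⁻¹ 1
  y c := single (Quotient.out c) 1
  map_mul_left := restrictCoeff_inclRingHom_mul k
  map_mul_right := restrictCoeff_mul_inclRingHom k
  sum_left s := by
    induction s using MonoidAlgebra.induction_linear with
    | zero => simp
    | add s s' h h' => simp only [add_mul, map_add, Finset.sum_add_distrib, h, h']
    | single g a =>
      have mem_iff (c : Gt ⧸ G) : g * Quotient.out c ∈ G ↔ (g⁻¹ : Gt) = c := by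
        conv_rhs => rw [← QuotientGroup.out_eq' c]
        rw [QuotientGroup.eq, inv_inv]
      rw [Finset.sum_eq_single ((g⁻¹ : Gt) : Gt ⧸ G)]
      · have h := (mem_iff _).2 rfl
        rw [single_mul_single, ← Subtype.coe_mk _ h, restrictCoeff_single_coe,
          inclRingHom_single, single_mul_single]
        simp
      · intro c _ hc
        rw [single_mul_single, restrictCoeff_single_of_notMem k
          (fun h => hc ((mem_iff c).1 h).symm), map_zero, zero_mul]
      · simp
  sum_right s := by
    induction s using MonoidAlgebra.induction_linear with
    | zero => simp
    | add s s' h h' => simp only [mul_add, map_add, Finset.sum_add_distrib, h, h']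
    | single g a =>
      have mem_iff (c : Gt ⧸ G) : (Quotient.out c)⁻¹ * g ∈ G ↔ c = (g : Gt) := by
        conv_rhs => rw [← QuotientGroup.out_eq' c]
        rw [QuotientGroup.eq]
      rw [Finset.sum_eq_single (g : Gt ⧸ G)]
      · have h := (mem_iff _).2 rfl
        rw [single_mul_single, ← Subtype.coe_mk _ h, restrictCoeff_single_coe,
          inclRingHom_single, single_mul_single]
        simp
      · intro c _ hc
        rw [single_mul_single, restrictCoeff_single_of_notMem k
          (fun h => hc ((mem_iff c).1 h)), map_zero, mul_zero]
      · simp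
  exists_mul_eq c r := ⟨_, (inclRingHom_conjRingHom_mul_single k _ r).symm⟩
  exists_mul_eq' c r := ⟨conjRingHom k Gt G (Quotient.out c)⁻¹ r, by
    rw [← inclRingHom_conjRingHom_mul_single, conjRingHom_conjRingHom_inv]⟩

end GroupAlgebra

/-- If `x M ≅ M` for all `x ∈ G̃`, then
`τ(Ind_G^{G̃} M) ≅ Ind_G^{G̃}(τ M)`, where `τ = Ω²` (group algebras are
symmetric) is computed via projective covers. -/
theorem tau_induced_iso_induced_tau
    (k : Type u) [Field k] [IsAlgClosed k] (p : ℕ) (hp : 0 < p) [CharP k p]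
    (Gt : Type u) [Group Gt] [Fintype Gt] (G : Subgroup Gt) [G.Normal]
    (M : Type u) [AddCommGroup M] [Module (MonoidAlgebra k ↥G) M]
    [Module.Finite (MonoidAlgebra k ↥G) M]
    (hM : ∀ x : Gt, IsConjStable k Gt G x M)
    -- a minimal projective presentation of M over kG; τ M = ker π₁
    (P₀ : Type u) [AddCommGroup P₀] [Module (MonoidAlgebra k ↥G) P₀]
    (π₀ : P₀ →ₗ[MonoidAlgebra k ↥G] M)
    (hπ₀ : IsProjCover (MonoidAlgebra k ↥G) π₀)
    (P₁ : Type u) [AddCommGroup P₁] [Module (MonoidAlgebra k ↥G) P₁]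
    (π₁ : P₁ →ₗ[MonoidAlgebra k ↥G] ↥(LinearMap.ker π₀))
    (hπ₁ : IsProjCover (MonoidAlgebra k ↥G) π₁)
    -- the induced module of M
    (N : Type u) [AddCommGroup N] [Module (MonoidAlgebra k Gt) N]
    (jM : M →+ N) (hN : IsInducedMod (inclRingHom k Gt G) M N jM)
    -- the induced module of τ M
    (NT : Type u) [AddCommGroup NT] [Module (MonoidAlgebra k Gt) NT]
    (jT : ↥(LinearMap.ker π₁) →+ NT)
    (hNT : IsInducedMod (inclRingHom k Gt G) ↥(LinearMap.ker π₁) NT jT)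
    -- a minimal projective presentation of Ind M over kG̃; τ(Ind M) = ker ϖ₁
    (Q₀ : Type u) [AddCommGroup Q₀] [Module (MonoidAlgebra k Gt) Q₀]
    (ϖ₀ : Q₀ →ₗ[MonoidAlgebra k Gt] N)
    (hϖ₀ : IsProjCover (MonoidAlgebra k Gt) ϖ₀)
    (Q₁ : Type u) [AddCommGroup Q₁] [Module (MonoidAlgebra k Gt) Q₁]
    (ϖ₁ : Q₁ →ₗ[MonoidAlgebra k Gt] ↥(LinearMap.ker ϖ₀))
    (hϖ₁ : IsProjCover (MonoidAlgebra k Gt) ϖ₁) :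
    Nonempty (↥(LinearMap.ker ϖ₁) ≃ₗ[MonoidAlgebra k Gt] NT) := by
  classical
  let F := groupFrobeniusSystem k Gt G
  obtain ⟨eN⟩ := hN.nonempty_equiv (F.isInducedMod M)
  obtain ⟨eT⟩ := hNT.nonempty_equiv (F.isInducedMod (LinearMap.ker π₁))
  obtain ⟨e₀⟩ := hϖ₀.nonempty_ker_equiv_s3 (F.isProjCover_map hπ₀) eN
  obtain ⟨e₁⟩ := hϖ₁.nonempty_ker_equiv_s3 (F.isProjCover_map hπ₁) (e₀ ≪≫ₗ Coind.kerEquiv π₀)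
  exact ⟨e₁ ≪≫ₗ Coind.kerEquiv π₁ ≪≫ₗ eT.symm⟩
end
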